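/- Let H be an integer d×n matrix with d ≥ n whose top n×n block H_B = H_{1:n,*} is nonsingular, let H_N = H_{(n+1):d,*} be the remaining rows, and let H_B* = det(H_B)·H_B^{−1} be the adjugate matrix of H_B. Then every entry of the m×n matrix H_N · H_B* has absolute value at most Δ_n(H), the maximum absolute value of the n×n minors of H; i.e. ‖H_N H_B*‖_max ≤ Δ(H). -/

import Mathlib

open Matrix

/-- `maxAbsSubdet k H` is `Δ_k(H)`: the maximum absolute value of the determinants of
all `k × k` submatrices of `H`. -/
def maxAbsSubdet {d n : ℕ} (k : ℕ) (H : Matrix (Fin d) (Fin n) ℤ) : ℕ :=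
  Finset.univ.sup fun p : (Fin k → Fin d) × (Fin k → Fin n) =>
    (H.submatrix p.1 p.2).det.natAbs

/-- The rule of Cramer for a product with the adjugate on the right. -/
theorem Matrix.mul_adjugate_apply_eq_det_updateRow {l n R : Type*} [Fintype n] [DecidableEq n]
    [CommRing R] (A : Matrix l n R) (B : Matrix n n R) (i : l) (j : n) :
    (A * B.adjugate) i j = (B.updateRow j (A i)).det := by
  rw [← cramer_transpose_apply, cramer_eq_adjugate_mulVec, ← adjugate_transpose,
    mulVec_transpose, mul_apply_eq_vecMul]

theorem natAbs_det_submatrix_le_maxAbsSubdet {d n k : ℕ} (H : Matrix (Fin d) (Fin n) ℤ)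
    (f : Fin k → Fin d) (g : Fin k → Fin n) :
    (H.submatrix f g).det.natAbs ≤ maxAbsSubdet k H :=
  Finset.le_sup (f := fun p : (Fin k → Fin d) × (Fin k → Fin n) =>
    (H.submatrix p.1 p.2).det.natAbs) (Finset.mem_univ (f, g))

/-- Let `H` be an integer `(n+m) × n` matrix (so `d = n + m ≥ n`)
whose top `n × n` block `H_B` is nonsingular, let `H_N` be the remaining `m` rows,
and let `H_B* = det(H_B) • H_B⁻¹` be the adjugate of `H_B`.  Then every entry of
`H_N * H_B*` has absolute value at most `Δ_n(H)`, i.e. `‖H_N H_B*‖_max ≤ Δ(H)`. -/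
theorem entries_mul_adjugate_le (n m : ℕ)
    (H : Matrix (Fin (n + m)) (Fin n) ℤ)
    (HB : Matrix (Fin n) (Fin n) ℤ) (hHB : HB = H.submatrix (Fin.castAdd m) id)
    (HN : Matrix (Fin m) (Fin n) ℤ) (hHN : HN = H.submatrix (Fin.natAdd n) id)
    (hdet : HB.det ≠ 0)
    (Δ : ℕ) (hΔ : Δ = maxAbsSubdet n H) :
    ∀ (i : Fin m) (j : Fin n), |(HN * HB.adjugate) i j| ≤ (Δ : ℤ) := by
  intro i j
  have hrow : HB.updateRow j (HN i) =
      H.submatrix (Function.update (Fin.castAdd m) j (Fin.natAdd n i)) id := by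
    subst hHB hHN
    ext a b
    by_cases h : a = j
    · subst h
      simp
    · simp [h]
  rw [mul_adjugate_apply_eq_det_updateRow, hrow, hΔ, Int.abs_eq_natAbs]
  exact_mod_cast natAbs_det_submatrix_le_maxAbsSubdet H _ id
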